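/- If V is a valuation domain of finite Krull dimension n, then dim(V[X]) = n + 1; in particular valuation domains are (stably) strong S-domains and Jaffard domains. -/

import Mathlib

set_option synthInstance.maxHeartbeats 1000000
set_option maxHeartbeats 1000000

open Polynomial

/-- `D` is a quasi-Prüfer domain: for each prime `P` of `D` and each prime `Q` of `D[X]`
with `Q ⊆ P[X]`, one has `Q = (Q ∩ D)[X]`. -/
def IsQuasiPrufer (D : Type*) [CommRing D] : Prop :=
  ∀ P : Ideal D, P.IsPrime → ∀ Q : Ideal D[X], Q.IsPrime →
    Q ≤ P.map (C : D →+* D[X]) → Q = (Q.comap (C : D →+* D[X])).map (C : D →+* D[X])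

/-- `D` is a Prüfer domain: every nonzero finitely generated ideal is invertible
(as a fractional ideal in the fraction field). -/
def IsPruferDom (D : Type*) [CommRing D] [IsDomain D] : Prop :=
  ∀ I : Ideal D, I ≠ ⊥ → I.FG →
    IsUnit (I : FractionalIdeal (nonZeroDivisors D) (FractionRing D))

/-- The valuative dimension of a domain: the supremum of the Krull dimensions of its
valuation overrings. -/
noncomputable def valuativeDim (R : Type*) [CommRing R] [IsDomain R] : WithBot ℕ∞ :=
  ⨆ (V : Subalgebra R (FractionRing R)) (_ : ValuationRing V), ringKrullDim V

/-- `P₁ ⊊ P₂` are adjacent primes: both prime, `P₁ < P₂`, and no prime strictly between. -/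
def AdjacentPrimes {R : Type*} [CommRing R] (P₁ P₂ : Ideal R) : Prop :=
  P₁.IsPrime ∧ P₂.IsPrime ∧ P₁ < P₂ ∧ ∀ Q : Ideal R, Q.IsPrime → P₁ < Q → ¬ Q < P₂

/-- `D` is a strong S-domain: adjacent primes `P₁ ⊊ P₂` extend to adjacent primes
`P₁[X] ⊊ P₂[X]` of `D[X]`. -/
def IsStrongS (D : Type*) [CommRing D] : Prop :=
  ∀ P₁ P₂ : Ideal D, AdjacentPrimes P₁ P₂ →
    AdjacentPrimes (P₁.map (C : D →+* D[X])) (P₂.map (C : D →+* D[X]))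

/-- Transcendence degree: the supremum of cardinalities of algebraically independent
subsets. -/
noncomputable def trdeg (F E : Type*) [CommRing F] [CommRing E] [Algebra F E] : Cardinal :=
  ⨆ s : {s : Set E // AlgebraicIndependent F ((↑) : s → E)}, Cardinal.mk s.1

section Pullback

variable (D : Type*) [CommRing D] [IsDomain D] (T : Subalgebra D (FractionRing D))
  (Q : Ideal T) [Q.IsPrime]

instance : IsDomain (Localization.AtPrime Q) :=
  IsLocalization.isDomain_localization Q.primeCompl_le_nonZeroDivisors

/-- The copy of the residue field `k(q) = Frac(D/q)` (where `q = Q ∩ D`) inside the residue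
field `k(Q) = T_Q/QT_Q`: the subfield generated by the image of `D`. -/
noncomputable def kqSub : Subfield (IsLocalRing.ResidueField (Localization.AtPrime Q)) :=
  Subfield.closure (Set.range ((IsLocalRing.residue (Localization.AtPrime Q)).comp
    ((algebraMap T (Localization.AtPrime Q)).comp (algebraMap D T))))

/-- The pullback ring `D(Q) = D_q + QT_Q`: the preimage of `k(q) ⊆ k(Q)` under the
canonical surjection `T_Q → k(Q)`. -/
noncomputable def DQ : Subring (Localization.AtPrime Q) :=
  (kqSub D T Q).toSubring.comap (IsLocalRing.residue (Localization.AtPrime Q))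

end Pullback

/-- A nonzero element of a free module over a valuation domain is a multiple of an element
with a unit coordinate. -/
theorem ValuationRing.exists_eq_smul_of_free (V : Type*) {M : Type*} [CommRing V] [IsDomain V]
    [ValuationRing V] [AddCommGroup M] [Module V M] [Module.Free V M] {m : M} (hm : m ≠ 0) :
    ∃ (c : V) (m₀ : M) (f : M →ₗ[V] V), c ≠ 0 ∧ m = c • m₀ ∧ f m₀ = 1 := by
  classical
  let b := Module.Free.chooseBasis V M
  have hne : (b.repr m).support.Nonempty := by
    simpa [Finsupp.support_nonempty_iff] using hm
  obtain ⟨i, hi, hdvd⟩ : ∃ i ∈ (b.repr m).support,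
      ∀ j ∈ (b.repr m).support, b.repr m i ∣ b.repr m j := by
    have key : ∀ s : Finset (Module.Free.ChooseBasisIndex V M), s.Nonempty →
        ∃ i ∈ s, ∀ j ∈ s, b.repr m i ∣ b.repr m j := by
      intro s hs
      induction hs using Finset.Nonempty.cons_induction with
      | singleton a => exact ⟨a, by simp⟩
      | cons a s ha hs ih =>
        obtain ⟨i, hi, h⟩ := ih
        rcases ValuationRing.dvd_total (b.repr m i) (b.repr m a) with h' | h'
        · refine ⟨i, by simp [hi], fun j hj ↦ ?_⟩
          rcases Finset.mem_cons.mp hj with rfl | hj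
          exacts [h', h j hj]
        · refine ⟨a, by simp, fun j hj ↦ ?_⟩
          rcases Finset.mem_cons.mp hj with rfl | hj
          exacts [dvd_rfl, h'.trans (h j hj)]
    exact key _ hne
  have hc : b.repr m i ≠ 0 := by simpa using hi
  choose! d hd using hdvd
  let m₀ : M := b.repr.symm (∑ j ∈ (b.repr m).support, Finsupp.single j (d j))
  have hm₀ : m = b.repr m i • m₀ := by
    apply b.repr.injective
    rw [map_smul, LinearEquiv.apply_symm_apply, Finset.smul_sum]
    conv_lhs => rw [← Finsupp.sum_single (b.repr m), Finsupp.sum]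
    exact Finset.sum_congr rfl fun j hj ↦ by rw [Finsupp.smul_single, smul_eq_mul, ← hd j hj]
  refine ⟨b.repr m i, m₀, b.coord i, hc, hm₀, ?_⟩
  have := congr(b.repr $hm₀ i)
  rw [map_smul, Finsupp.smul_apply, smul_eq_mul] at this
  exact (mul_left_cancel₀ hc (by simpa using this)).symm

theorem LinearMap.apply_mem_of_mem_map_algebraMap {R S : Type*} [CommRing R] [CommRing S]
    [Algebra R S] (f : S →ₗ[R] R) {I : Ideal R} {x : S} (hx : x ∈ I.map (algebraMap R S)) :
    f x ∈ I := by
  replace hx : x ∈ I • (⊤ : Submodule R S) := by rwa [Ideal.smul_top_eq_map]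
  refine Submodule.smul_induction_on hx (fun r hr n _ ↦ ?_) fun x y hx hy ↦ ?_
  · simpa using I.mul_mem_right _ hr
  · simpa using I.add_mem hx hy

/-- Valuation domains are quasi-Prüfer. -/
theorem ValuationRing.isQuasiPrufer (V : Type*) [CommRing V] [IsDomain V] [ValuationRing V] :
    IsQuasiPrufer V := by
  intro P hP Q hQ hQP
  refine le_antisymm (fun g hg ↦ ?_) Ideal.map_comap_le
  by_cases h0 : g = 0
  · simp [h0]
  obtain ⟨c, g₀, f, hc, rfl, hf⟩ := ValuationRing.exists_eq_smul_of_free V h0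
  have hg₀ : g₀ ∉ Q := fun h ↦ hP.ne_top <| P.eq_top_iff_one.mpr <|
    hf ▸ f.apply_mem_of_mem_map_algebraMap (hQP h)
  rw [smul_eq_C_mul] at hg ⊢
  exact Ideal.mul_mem_right _ _ (Ideal.mem_map_of_mem _ ((hQ.mem_or_mem hg).resolve_right hg₀))

/-- There is no chain of three primes of `R[X]` lying over the same prime of `R`. -/
theorem Polynomial.not_lt_of_lt_of_comap_eq {R : Type*} [CommRing R]
    {P Q T : PrimeSpectrum R[X]} (hPQ : P < Q) (hQT : Q < T)
    (h₁ : P.comap C = Q.comap C) (h₂ : T.comap C = Q.comap C) : False := by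
  let p := Q.comap (C : R →+* R[X])
  have hdim : Order.krullDim (PrimeSpectrum.comap (algebraMap R R[X]) ⁻¹' {p}) ≤ 1 := by
    rw [Order.krullDim_eq_of_orderIso
      (PrimeSpectrum.preimageOrderIsoFiber R (Polynomial R) p), ← ringKrullDim,
      ← ringKrullDim_eq_of_ringEquiv (polyEquivTensor R (p.asIdeal.ResidueField)).toRingEquiv]
    exact Ring.krullDimLE_iff.mp inferInstance
  let s : LTSeries (PrimeSpectrum.comap (algebraMap R R[X]) ⁻¹' {p}) :=
    ⟨2, ![⟨P, h₁⟩, ⟨Q, rfl⟩, ⟨T, h₂⟩], by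
      intro i
      fin_cases i
      exacts [hPQ, hQT]⟩
  have := (Order.LTSeries.length_le_krullDim s).trans hdim
  exact absurd this (by simp only [s]; norm_num)

theorem IsQuasiPrufer.ringKrullDim_polynomial_le {R : Type*} [CommRing R]
    (h : IsQuasiPrufer R) {n : ℕ} (hn : ringKrullDim R = n) :
    ringKrullDim R[X] ≤ ((n + 1 : ℕ) : WithBot ℕ∞) := by
  classical
  have hle (p : PrimeSpectrum R) : Order.height p ≤ n := by
    have := Order.height_le_krullDim p
    rw [← ringKrullDim, hn] at this
    exact_mod_cast this
  have hlt (p : PrimeSpectrum R) : Order.height p < ⊤ :=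
    (hle p).trans_lt (ENat.natCast_lt_top n)
  let ht (p : PrimeSpectrum R) : ℕ := (Order.height p).toNat
  have hht (p q : PrimeSpectrum R) (hpq : p < q) : ht p < ht q := by
    have := Order.height_strictMono hpq (hlt p)
    rwa [← ENat.natCast_toNat (hlt p).ne, ← ENat.natCast_toNat (hlt q).ne, Nat.cast_lt] at this
  have hhtn (p : PrimeSpectrum R) : ht p ≤ n := ENat.toNat_le_of_le_natCast (hle p)
  let ε (Q : PrimeSpectrum R[X]) : ℕ :=
    if Q.asIdeal = (Q.asIdeal.comap C).map (C : R →+* R[X]) then 0 else 1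
  let φ (Q : PrimeSpectrum R[X]) : ℕ := ht (Q.comap C) + ε Q
  have hε (Q) : ε Q ≤ 1 := by simp only [ε]; split_ifs <;> simp
  have hφ : StrictMono φ := by
    intro Q T hQT
    rcases (show Q.comap C ≤ T.comap C from Ideal.comap_mono hQT.le).eq_or_lt with heq | hlt'
    · have hT : ε T = 1 := by
        refine if_neg fun hT ↦ hQT.not_ge ?_
        change T.asIdeal ≤ Q.asIdeal
        rw [hT, Ideal.map_le_iff_le_comap]
        exact heq.ge
      have hQ : ε Q = 0 := by
        refine if_pos ?_
        by_contra hne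
        let P : PrimeSpectrum R[X] :=
          ⟨(Q.asIdeal.comap C).map C, Ideal.isPrime_map_C_of_isPrime⟩
        refine Polynomial.not_lt_of_lt_of_comap_eq (P := P) (lt_of_le_of_ne Ideal.map_comap_le
          fun hPQ ↦ hne congr($(hPQ.symm).asIdeal)) hQT (PrimeSpectrum.ext ?_) heq.symm
        simp [P, Ideal.comap_map_comap]
      simp [φ, heq, hT, hQ]
    · have h₁ := hht _ _ hlt'
      have h₂ := hε Q
      by_cases hT : T.asIdeal = (T.asIdeal.comap C).map (C : R →+* R[X])
      · have hQ : ε Q = 0 := if_pos (h _ (inferInstance : (T.asIdeal.comap C).IsPrime) _ Q.2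
          (hT ▸ hQT.le))
        simp only [φ, hQ]
        omega
      · have hT : ε T = 1 := if_neg hT
        simp only [φ, hT]
        omega
  refine iSup_le fun s ↦ ?_
  have h₁ := LTSeries.head_add_length_le_nat (s.map φ hφ)
  have h₂ : (s.map φ hφ).last ≤ n + 1 := by
    rw [LTSeries.last_map]
    exact add_le_add (hhtn _) (hε _)
  have h₃ : (s.map φ hφ).length = s.length := rfl
  exact_mod_cast (show s.length ≤ n + 1 by omega)

theorem ValuationRing.ringKrullDim_subalgebra_le {V K : Type*} [CommRing V] [IsDomain V]
    [ValuationRing V] [Field K] [Algebra V K] [IsFractionRing V K] (W : Subalgebra V K) :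
    ringKrullDim W ≤ ringKrullDim V := by
  refine Order.krullDim_le_of_strictMono (PrimeSpectrum.comap (algebraMap V W)) fun Q T hQT ↦ ?_
  refine lt_of_le_not_ge (Ideal.comap_mono hQT.le) fun hTQ ↦ ?_
  obtain ⟨x, hxT, hxQ⟩ := Set.exists_of_ssubset (show (Q.asIdeal : Set W) ⊂ T.asIdeal from hQT)
  rcases ValuationRing.isInteger_or_isInteger V (x : K) with ⟨y, hy⟩ | ⟨y, hy⟩
  · have hyx : algebraMap V W y = x := Subtype.ext hy
    exact hxQ (hyx ▸ hTQ (show algebraMap V W y ∈ T.asIdeal from hyx ▸ hxT))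
  · have hx0 : (x : K) ≠ 0 := fun h ↦ hxQ (by
      rw [show x = 0 from Subtype.ext h]; exact zero_mem _)
    have : algebraMap V W y * x = 1 := Subtype.ext (by
      change algebraMap V K y * x = 1
      rw [hy, inv_mul_cancel₀ hx0])
    exact T.2.ne_top (T.asIdeal.eq_top_iff_one.mpr (this ▸ T.asIdeal.mul_mem_left _ hxT))

theorem ValuationRing.valuativeDim_eq (V : Type*) [CommRing V] [IsDomain V] [ValuationRing V] :
    valuativeDim V = ringKrullDim V := by
  refine le_antisymm (iSup₂_le fun W _ ↦ ringKrullDim_subalgebra_le W) ?_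
  let e : V ≃ₐ[V] (⊥ : Subalgebra V (FractionRing V)) :=
    (Algebra.botEquivOfInjective (IsFractionRing.injective V (FractionRing V))).symm
  rw [ringKrullDim_eq_of_ringEquiv e.toRingEquiv]
  exact le_iSup₂_of_le (⊥ : Subalgebra V (FractionRing V)) (e.surjective.valuationRing
    (e : V →+* (⊥ : Subalgebra V (FractionRing V)))) le_rfl

/-- In an algebra of finite type, a prime comparable to no other prime in its fibre is a
point of quasi-finiteness. -/
theorem Algebra.QuasiFiniteAt.of_forall_eq {R S : Type*} [CommRing R] [CommRing S] [Algebra R S]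
    [Algebra.FiniteType R S] (q : PrimeSpectrum S)
    (h : ∀ q' : PrimeSpectrum S, q'.comap (algebraMap R S) = q.comap (algebraMap R S) →
      q' ≤ q ∨ q ≤ q' → q' = q) :
    Algebra.QuasiFiniteAt R q.asIdeal := by
  refine .of_isOpen_singleton_fiber q ?_
  let p := q.comap (algebraMap R S)
  let e := PrimeSpectrum.preimageHomeomorphFiber R S p
  let o := PrimeSpectrum.preimageOrderIsoFiber R S p
  have : IsNoetherianRing (p.asIdeal.Fiber S) :=
    Algebra.FiniteType.isNoetherianRing p.asIdeal.ResidueField _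
  have : IsJacobsonRing (p.asIdeal.Fiber S) :=
    isJacobsonRing_of_finiteType (A := p.asIdeal.ResidueField)
  rw [← e.isOpen_image, Set.image_singleton]
  have key (y : PrimeSpectrum (p.asIdeal.Fiber S)) (hy : y ≤ o ⟨q, rfl⟩ ∨ o ⟨q, rfl⟩ ≤ y) :
      y = o ⟨q, rfl⟩ := by
    obtain ⟨⟨q', hq'⟩, rfl⟩ := o.surjective y
    simp only [OrderIso.le_iff_le] at hy
    exact congr_arg o (Subtype.ext (h q' hq' hy))
  have htfae := (PrimeSpectrum.isOpen_singleton_tfae_of_isNoetherian_of_isJacobsonRing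
    (o ⟨q, rfl⟩)).out 0 2
  refine htfae.mpr ⟨?_, ?_⟩
  · rw [PrimeSpectrum.isClosed_singleton_iff_isMaximal, ← PrimeSpectrum.isMax_iff]
    exact fun y hy ↦ (key y (.inr hy)).le
  · rintro x y hxy rfl
    exact key y (.inl ((PrimeSpectrum.le_iff_specializes _ _).mpr hxy))

/-- The case of a height one prime lying over zero: localizing, one reduces to algebras over a
field, which are Noetherian. -/
theorem Polynomial.eq_bot_of_lt_map_C_of_comap_eq_bot {V A : Type*} [CommRing V] [IsDomain V]
    [CommRing A] [IsDomain A] [Algebra V A] [Algebra.FiniteType V A] {P : Ideal A} [P.IsPrime]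
    (hP0 : P ≠ ⊥) (hP : ∀ Q : Ideal A, Q.IsPrime → Q ≠ ⊥ → Q ≤ P → Q = P)
    (hPV : P.comap (algebraMap V A) = ⊥) {Q : Ideal A[X]} [hQ : Q.IsPrime]
    (hQP : Q < P.map (C : A →+* A[X])) : Q = ⊥ := by
  have hPX : (P.map (C : A →+* A[X])).IsPrime := Ideal.isPrime_map_C_of_isPrime
  let M := P.map (C : A →+* A[X])
  let L := Localization.AtPrime M
  let K := FractionRing V
  have hu (v : nonZeroDivisors V) : IsUnit (algebraMap V L v) := by
    rw [IsScalarTower.algebraMap_apply V A[X] L]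
    refine IsLocalization.map_units (M := M.primeCompl) L ⟨algebraMap V A[X] v, fun hv ↦ ?_⟩
    have : (v : V) ∈ P.comap (algebraMap V A) := by
      rw [SetLike.mem_coe, Ideal.mem_map_C_iff] at hv
      simpa using hv 0
    exact nonZeroDivisors.ne_zero v.2 (by rwa [hPV, Ideal.mem_bot] at this)
  let _ : Algebra K L := (IsLocalization.lift (M := nonZeroDivisors V) hu).toAlgebra
  have : IsScalarTower V K L := .of_algebraMap_eq' (IsLocalization.lift_comp hu).symm
  have : Algebra.EssFiniteType V L := inferInstance
  have : Algebra.EssFiniteType K L := .of_comp V K L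
  have : IsNoetherianRing L := Algebra.EssFiniteType.isNoetherianRing K L
  have : IsDomain L := IsLocalization.isDomain_localization M.primeCompl_le_nonZeroDivisors
  have hmc : (IsLocalRing.maximalIdeal L).comap (algebraMap A[X] L) = M :=
    Localization.AtPrime.under_maximalIdeal
  obtain ⟨a, haP, ha0⟩ := Submodule.exists_mem_ne_zero_of_ne_bot hP0
  have hmin : IsLocalRing.maximalIdeal L ∈
      (Ideal.span {algebraMap A[X] L (C a)}).minimalPrimes := by
    rw [← Localization.AtPrime.map_eq_maximalIdeal]
    refine ⟨⟨Localization.AtPrime.map_eq_maximalIdeal (I := M) ▸ inferInstance, ?_⟩, ?_⟩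
    · rw [Ideal.span_singleton_le_iff_mem]
      exact Ideal.mem_map_of_mem _ (Ideal.mem_map_of_mem _ haP)
    · rintro J ⟨hJ, haJ⟩ -
      rw [Ideal.span_singleton_le_iff_mem] at haJ
      have hJM : J.comap (algebraMap A[X] L) ≤ M := by
        exact (Ideal.comap_mono (IsLocalRing.le_maximalIdeal hJ.ne_top)).trans hmc.le
      have hJP : (J.comap (algebraMap A[X] L)).comap C = P := by
        refine hP _ inferInstance (fun h ↦ ha0 ?_) ?_
        · rw [← Ideal.mem_bot, ← h]
          exact haJ
        · refine (Ideal.comap_mono hJM).trans fun x hx ↦ ?_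
          rw [Ideal.mem_comap, Ideal.mem_map_C_iff] at hx
          simpa using hx 0
      rw [Ideal.map_le_iff_le_comap, Ideal.map_le_iff_le_comap]
      exact hJP.ge
  have hht := Ideal.height_le_one_of_isPrincipal_of_mem_minimalPrimes _ _ hmin
  have hdisj : Disjoint (M.primeCompl : Set A[X]) (Q : Set A[X]) :=
    Set.disjoint_left.mpr fun x hx hxQ ↦ hx (hQP.le hxQ)
  have hJ : (Q.map (algebraMap A[X] L)).IsPrime :=
    IsLocalization.isPrime_of_isPrime_disjoint M.primeCompl L Q hQ hdisj
  have hJc : (Q.map (algebraMap A[X] L)).comap (algebraMap A[X] L) = Q :=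
    IsLocalization.under_map_of_isPrime_disjoint M.primeCompl L hQ hdisj
  have hJm : Q.map (algebraMap A[X] L) < IsLocalRing.maximalIdeal L := by
    refine (IsLocalRing.le_maximalIdeal hJ.ne_top).lt_of_ne fun h ↦ hQP.ne ?_
    rw [← hJc, h, hmc]
  have hJ0 := (Ideal.height_le_iff.mp hht) _ hJ hJm
  rw [Nat.cast_one, Order.lt_one_iff, Ideal.height_eq_zero_iff_eq_bot] at hJ0
  rw [← hJc, hJ0, Ideal.comap_bot_of_injective]
  exact IsLocalization.injective L M.primeCompl_le_nonZeroDivisors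

/-- A domain of finite type over a ring, quasi-finite at some prime, is algebraic. -/
theorem Algebra.IsAlgebraic.of_quasiFiniteAt {R S : Type*} [CommRing R] [IsDomain R] [CommRing S]
    [IsDomain S] [Algebra R S] [Algebra.FiniteType R S] (P : Ideal S) [P.IsPrime]
    [Algebra.QuasiFiniteAt R P] : Algebra.IsAlgebraic R S := by
  obtain ⟨r, hrP, hr⟩ := Algebra.zariskisMainProperty_iff'.mp
    (Algebra.ZariskisMainProperty.of_finiteType (R := R) P)
  have hr0 : r ≠ 0 := fun h ↦ hrP (h ▸ P.zero_mem)
  obtain ⟨k, hk⟩ := hr r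
  rw [← pow_succ] at hk
  have hralg : IsAlgebraic R r := hk.isAlgebraic.of_pow k.succ_pos
  refine ⟨fun x ↦ ?_⟩
  obtain ⟨m, hm⟩ := hr x
  exact .of_mul (mem_nonZeroDivisors_of_ne_zero (pow_ne_zero m hr0)) (hralg.pow m) hm.isAlgebraic

/-- A prime minimal among nonzero primes, and not lying over zero, is quasi-finite over the
polynomial ring on lifts of a transcendence basis of its residue ring. -/
theorem Ideal.exists_mvPolynomial_quasiFiniteAt.{u, v} (V : Type u) {A : Type v} [CommRing V]
    [IsDomain V] [CommRing A] [IsDomain A] [Algebra V A]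
    [FaithfulSMul V A] [Algebra.FiniteType V A] {P : Ideal A} [P.IsPrime]
    (hP : ∀ Q : Ideal A, Q.IsPrime → Q ≠ ⊥ → Q ≤ P → Q = P)
    (hPV : P.under V ≠ ⊥) :
    ∃ (ι : Type v) (_ : Algebra (MvPolynomial ι V) A) (_ : IsScalarTower V (MvPolynomial ι V) A),
      P.under (MvPolynomial ι V) = (P.under V).map MvPolynomial.C ∧
      Algebra.QuasiFiniteAt (MvPolynomial ι V) P := by
  let p := P.under V
  obtain ⟨ι, y, hy⟩ := exists_isTranscendenceBasis' (V ⧸ p) (A ⧸ P)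
  choose x hxy using fun i ↦ Ideal.Quotient.mk_surjective (y i)
  let S := MvPolynomial ι V
  let _ : Algebra S A := (MvPolynomial.aeval x : S →ₐ[V] A).toAlgebra
  have hST : IsScalarTower V S A := .of_algebraMap_eq' (MvPolynomial.aeval x).comp_algebraMap.symm
  have : Algebra.FiniteType S A := .of_restrictScalars_finiteType V S A
  have hmk (f : S) : Ideal.Quotient.mk P (algebraMap S A f) =
      MvPolynomial.aeval y (MvPolynomial.map (Ideal.Quotient.mk p) f) := by
    refine congr($(MvPolynomial.ringHom_ext (f := (Ideal.Quotient.mk P).comp (algebraMap S A))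
      (g := (MvPolynomial.aeval (R := V ⧸ p) y : _ →+* A ⧸ P).comp
        (MvPolynomial.map (Ideal.Quotient.mk p))) (fun r ↦ ?_) fun i ↦ ?_) f)
    · simp [RingHom.algebraMap_toAlgebra]
    · simp [RingHom.algebraMap_toAlgebra, hxy]
  have hunder : P.under S = p.map MvPolynomial.C := by
    ext f
    rw [Ideal.under_def, Ideal.mem_comap, ← Ideal.Quotient.eq_zero_iff_mem, hmk,
      map_eq_zero_iff _ hy.1, MvPolynomial.mem_map_C_iff, MvPolynomial.ext_iff]
    simp [MvPolynomial.coeff_map, Ideal.Quotient.eq_zero_iff_mem]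
  refine ⟨ι, _, hST, hunder, Algebra.QuasiFiniteAt.of_forall_eq ⟨P, inferInstance⟩ ?_⟩
  rintro ⟨q, hq⟩ hqS (hqP | hPq)
  · have hqS : q.under S = P.under S := congr($(hqS).asIdeal)
    refine PrimeSpectrum.ext (hP q hq (fun h ↦ ?_) hqP)
    obtain ⟨z, hz, hz0⟩ := Submodule.exists_mem_ne_zero_of_ne_bot hPV
    have hzS : algebraMap V S z ∈ q.under S := by
      rw [hqS, Ideal.under_def, Ideal.mem_comap, ← IsScalarTower.algebraMap_apply]
      exact hz
    rw [Ideal.under_def, Ideal.mem_comap, ← IsScalarTower.algebraMap_apply, h, Ideal.mem_bot,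
      FaithfulSMul.algebraMap_eq_zero_iff] at hzS
    exact hz0 hzS
  · have hqS : q.under S = P.under S := congr($(hqS).asIdeal)
    refine PrimeSpectrum.ext (le_antisymm (fun a ha ↦ ?_) hPq)
    by_contra haP
    have ha0 : Ideal.Quotient.mk P a ≠ 0 := by rwa [Ne, Ideal.Quotient.eq_zero_iff_mem]
    have halg := hy.isAlgebraic.isAlgebraic (Ideal.Quotient.mk P a)
    obtain ⟨⟨r, hr⟩, hr0, hdvd⟩ :=
      halg.exists_nonzero_dvd (mem_nonZeroDivisors_of_ne_zero ha0)
    rw [Algebra.adjoin_range_eq_range_aeval] at hr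
    obtain ⟨g, rfl⟩ := hr
    obtain ⟨f, rfl⟩ := MvPolynomial.map_surjective _ Ideal.Quotient.mk_surjective g
    obtain ⟨b, hb⟩ := hdvd
    obtain ⟨b, rfl⟩ := Ideal.Quotient.mk_surjective b
    change MvPolynomial.aeval y (MvPolynomial.map (Ideal.Quotient.mk p) f) = _ at hb
    have hf : f ∈ q.under S := by
      rw [← hmk, ← map_mul, Ideal.Quotient.eq] at hb
      rw [Ideal.under_def, Ideal.mem_comap]
      simpa using q.add_mem (hPq hb) (q.mul_mem_right b ha)
    refine hr0 (Subtype.ext ?_)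
    rw [hqS, Ideal.under_def, Ideal.mem_comap, ← Ideal.Quotient.eq_zero_iff_mem, hmk] at hf
    exact hf

/-- Over a valuation domain `V`, a prime of a polynomial ring `A[X]` over a `V`-algebra of finite
type which lies strictly between zero and the extension of a prime of `A` minimal among nonzero
primes must meet `A` nontrivially. -/
theorem ValuationRing.eq_bot_of_lt_map_C (V : Type*) {A : Type*} [CommRing V] [IsDomain V]
    [ValuationRing V] [CommRing A] [IsDomain A] [Algebra V A] [FaithfulSMul V A]
    [Algebra.FiniteType V A] {P : Ideal A} [P.IsPrime] (hP0 : P ≠ ⊥)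
    (hP : ∀ Q : Ideal A, Q.IsPrime → Q ≠ ⊥ → Q ≤ P → Q = P) {Q : Ideal A[X]} [Q.IsPrime]
    (hQP : Q < P.map (C : A →+* A[X])) : Q = ⊥ := by
  by_cases hPV : P.under V = ⊥
  · exact Polynomial.eq_bot_of_lt_map_C_of_comap_eq_bot hP0 hP hPV hQP
  by_contra hQ0
  have hQA : Q.comap C = ⊥ := by
    by_contra h
    refine hQP.not_ge (Ideal.map_le_iff_le_comap.mpr (hP _ inferInstance h ?_).ge)
    refine (Ideal.comap_mono hQP.le).trans fun x hx ↦ ?_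
    rw [Ideal.mem_comap, Ideal.mem_map_C_iff] at hx
    simpa using hx 0
  obtain ⟨ι, _, _, hunder, _⟩ := Ideal.exists_mvPolynomial_quasiFiniteAt V hP hPV
  let S := MvPolynomial ι V
  have : Algebra.FiniteType S A := .of_restrictScalars_finiteType V S A
  have : Algebra.IsAlgebraic S A := .of_quasiFiniteAt P
  have hinj : Function.Injective (algebraMap S A) := by
    refine (injective_iff_map_eq_zero _).mpr fun f hf ↦ ?_
    by_contra hf0
    obtain ⟨c, f₀, φ, hc, rfl, hφ⟩ := ValuationRing.exists_eq_smul_of_free V hf0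
    rw [← IsScalarTower.coe_toAlgHom' V S A, map_smul, IsScalarTower.coe_toAlgHom',
      Algebra.smul_def, mul_eq_zero, FaithfulSMul.algebraMap_eq_zero_iff,
      or_iff_right hc] at hf
    have hf₀ : f₀ ∈ P.under S := by
      rw [Ideal.under_def, Ideal.mem_comap, hf]
      exact P.zero_mem
    rw [hunder] at hf₀
    have := φ.apply_mem_of_mem_map_algebraMap hf₀
    rw [hφ, ← Ideal.eq_top_iff_one] at this
    exact (inferInstance : (P.under V).IsPrime).ne_top this
  have : FaithfulSMul S A := (faithfulSMul_iff_algebraMap_injective S A).mpr hinj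
  obtain ⟨g, hgQ, hg0⟩ := Submodule.exists_mem_ne_zero_of_ne_bot hQ0
  obtain ⟨G, hG0, hGQ⟩ : ∃ G : S[X], G ≠ 0 ∧ G.map (algebraMap S A) ∈ Q := by
    let π := Ideal.Quotient.mk Q
    have hAB : Function.Injective (algebraMap A (A[X] ⧸ Q)) := by
      refine (injective_iff_map_eq_zero _).mpr fun a ha ↦ ?_
      rw [← Ideal.mem_bot, ← hQA]
      exact Ideal.Quotient.eq_zero_iff_mem (I := Q).mp ha
    have haeval (h : A[X]) : aeval (π X) h = π h :=
      congr($(algHom_ext (f := aeval (π X)) (g := Ideal.Quotient.mkₐ A Q) (by simp [π])) h)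
    have hA : IsAlgebraic A (π X) :=
      ⟨g, hg0, by rw [haeval, Ideal.Quotient.eq_zero_iff_mem]; exact hgQ⟩
    obtain ⟨G, hG0, hG⟩ := hA.restrictScalars S
    refine ⟨G, hG0, ?_⟩
    rw [← Ideal.Quotient.eq_zero_iff_mem]
    change π _ = 0
    rw [← haeval, aeval_map_algebraMap, hG]
  have : Module.Free V S[X] := .trans (R := V) (S := S)
  obtain ⟨c, G₀, φ, hc, rfl, hφ⟩ := ValuationRing.exists_eq_smul_of_free V hG0
  have hG₀ : G₀.map (algebraMap S A) ∈ Q := by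
    rw [Algebra.smul_def, Polynomial.map_mul, Polynomial.algebraMap_apply, Polynomial.map_C,
      ← IsScalarTower.algebraMap_apply] at hGQ
    refine ((inferInstance : Q.IsPrime).mem_or_mem hGQ).resolve_left fun h ↦ hc ?_
    rwa [← Ideal.mem_comap, hQA, Ideal.mem_bot, FaithfulSMul.algebraMap_eq_zero_iff] at h
  have hG₀V : G₀ ∈ (P.under V).map (algebraMap V S[X]) := by
    rw [IsScalarTower.algebraMap_eq V S S[X], ← Ideal.map_map, Polynomial.algebraMap_eq,
      Ideal.mem_map_C_iff]
    intro k
    have := Ideal.mem_map_C_iff.mp (hQP.le hG₀) k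
    rw [coeff_map, ← Ideal.mem_comap, ← Ideal.under_def, hunder] at this
    exact this
  have := φ.apply_mem_of_mem_map_algebraMap hG₀V
  rw [hφ, ← Ideal.eq_top_iff_one] at this
  exact (inferInstance : (P.under V).IsPrime).ne_top this

/-- Algebras of finite type over a valuation domain are strong S-rings. -/
theorem ValuationRing.isStrongS_of_finiteType (V : Type*) {R : Type*} [CommRing V] [IsDomain V]
    [ValuationRing V] [CommRing R] [Algebra V R] [Algebra.FiniteType V R] : IsStrongS R := by
  rintro P₁ P₂ ⟨h₁, h₂, hlt, hadj⟩
  have hcomap (I : Ideal R) : (I.map (C : R →+* R[X])).comap C = I := by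
    refine le_antisymm (fun x hx ↦ ?_) Ideal.le_comap_map
    rw [Ideal.mem_comap, Ideal.mem_map_C_iff] at hx
    simpa using hx 0
  refine ⟨Ideal.isPrime_map_C_of_isPrime, Ideal.isPrime_map_C_of_isPrime,
    (Ideal.map_mono hlt.le).lt_of_ne fun h ↦ hlt.ne ?_, fun Q hQ hPQ hQP ↦ ?_⟩
  · rw [← hcomap P₁, h, hcomap]
  have : ValuationRing (V ⧸ P₁.under V) :=
    Ideal.Quotient.mk_surjective.valuationRing (Ideal.Quotient.mk (P₁.under V))
  have hmk := Ideal.Quotient.mk_surjective (I := P₁)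
  let π := mapRingHom (Ideal.Quotient.mk P₁)
  have hπ : Function.Surjective π := map_surjective _ hmk
  have hker : RingHom.ker π = P₁.map C := by rw [ker_mapRingHom, Ideal.mk_ker]
  have hcm (I : Ideal R) (hI : P₁ ≤ I) :
      (I.map (Ideal.Quotient.mk P₁)).comap (Ideal.Quotient.mk P₁) = I := by
    rw [Ideal.comap_map_of_surjective' _ hmk, Ideal.mk_ker, sup_eq_left.mpr hI]
  have hcm' (I : Ideal R[X]) (hI : P₁.map C ≤ I) : (I.map π).comap π = I := by
    rw [Ideal.comap_map_of_surjective' _ hπ, hker, sup_eq_left.mpr hI]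
  have : (P₂.map (Ideal.Quotient.mk P₁)).IsPrime :=
    Ideal.map_isPrime_of_surjective hmk (by rw [Ideal.mk_ker]; exact hlt.le)
  have : (Q.map π).IsPrime := Ideal.map_isPrime_of_surjective hπ (hker.trans_le hPQ.le)
  have hQ0 := ValuationRing.eq_bot_of_lt_map_C (V ⧸ P₁.under V)
    (P := P₂.map (Ideal.Quotient.mk P₁)) (Q := Q.map π) (fun h ↦ ?_) (fun J hJ hJ0 hJP ↦ ?_) ?_
  · refine hPQ.not_ge ?_
    rw [← hker, ← Ideal.map_eq_bot_iff_le_ker, hQ0]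
  · rw [Ideal.map_eq_bot_iff_le_ker, Ideal.mk_ker] at h
    exact hlt.not_ge h
  · have hJ₁ : P₁ ≤ J.comap (Ideal.Quotient.mk P₁) :=
      Ideal.mk_ker.ge.trans (Ideal.comap_mono bot_le)
    have hJ₂ : J.comap (Ideal.Quotient.mk P₁) ≤ P₂ := by
      rw [← hcm P₂ hlt.le]
      exact Ideal.comap_mono hJP
    have hJ₃ : J.comap (Ideal.Quotient.mk P₁) = P₂ := by
      refine hJ₂.eq_of_not_lt (hadj _ inferInstance (hJ₁.lt_of_ne fun h ↦ hJ0 ?_))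
      rw [← Ideal.map_comap_of_surjective _ hmk J, ← h, Ideal.map_quotient_self]
    rw [← hJ₃, Ideal.map_comap_of_surjective _ hmk]
  · have hmap : (P₂.map (Ideal.Quotient.mk P₁)).map C = (P₂.map C).map π := by
      rw [Ideal.map_map, Ideal.map_map, mapRingHom_comp_C]
    rw [hmap]
    refine (Ideal.map_mono hQP.le).lt_of_ne fun h ↦ hQP.ne ?_
    rw [← hcm' Q hPQ.le, h, hcm' _ (Ideal.map_mono hlt.le)]

/-- A valuation domain `V` of finite Krull dimension `n` satisfies
`dim V[X] = n + 1`; in particular valuation domains are (stably) strong S-domains and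
Jaffard domains. -/
theorem statement_18 (V : Type*) [CommRing V] [IsDomain V] [ValuationRing V] (n : ℕ)
    (hdim : ringKrullDim V = n) :
    ringKrullDim V[X] = ((n + 1 : ℕ) : WithBot ℕ∞) ∧
    (∀ m : ℕ, IsStrongS (MvPolynomial (Fin m) V)) ∧ IsStrongS V ∧
    ringKrullDim V = valuativeDim V := by
  refine ⟨le_antisymm ((ValuationRing.isQuasiPrufer V).ringKrullDim_polynomial_le hdim) ?_,
    fun m ↦ ValuationRing.isStrongS_of_finiteType V, ValuationRing.isStrongS_of_finiteType V,
    (ValuationRing.valuativeDim_eq V).symm⟩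
  rw [Nat.cast_add, Nat.cast_one, ← hdim]
  exact ringKrullDim_succ_le_ringKrullDim_polynomial
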